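/- Assume p⁻_{s⁻} > 0 for every s⁻ ∈ S⁻. For x ∈ Σ define the probability measure μ_{x̂} on Σ supported on the finite set x̂ = σ⁻¹({x}) = {x̂(s) : s ∈ φ⁻¹(x_{−1})} by μ_{x̂}({x̂(s)}) := p⁺_s / p⁻_{x_{−1}}. Then (μ_{x̂})_{x̂ ∈ σ⁻¹(ε)} is a disintegration of μ with respect to the partition σ⁻¹(ε): μ_{x̂}(x̂) = 1 for every x, the map x̂ ↦ μ_{x̂}(M) is measurable for every measurable M, and μ(M) = ∫_{x̂ ∈ σ⁻¹(ε)} μ_{x̂}(M) dμ̂(x̂) for every measurable M. -/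

import Mathlib

open MeasureTheory Filter Real

namespace ZipShiftPaper

variable {Sm Sp : Type*}

/-- `s` is an admissible symbol for index `i`: a negative symbol (inl) if `i < 0`,
a positive symbol (inr) if `i ≥ 0`. -/
def Adm (i : ℤ) (s : Sm ⊕ Sp) : Prop :=
  if i < 0 then s.isLeft = true else s.isRight = true

/-- The zip shift space: bilateral sequences with positive symbols on indices `≥ 0`
and negative symbols on indices `< 0`. -/
def ZipSpace (Sm Sp : Type*) := {x : ℤ → Sm ⊕ Sp // ∀ i, Adm i (x i)}

variable (φ : Sp → Sm)

/-- The transition function applied to a combined symbol. -/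
def phiHat : Sm ⊕ Sp → Sm ⊕ Sp
  | .inl t => .inl t
  | .inr s => .inl (φ s)

lemma adm_shift (x : ZipSpace Sm Sp) (i : ℤ) :
    Adm i (if i = -1 then phiHat φ (x.1 0) else x.1 (i + 1)) := by
  by_cases h : i = -1
  · subst h
    have h0 := x.2 0
    simp only [Adm, if_neg (by norm_num : ¬ (0:ℤ) < 0)] at h0
    simp only [if_pos rfl, Adm, if_pos (by norm_num : (-1:ℤ) < 0)]
    rcases hx : x.1 0 with t | s
    · rw [hx] at h0; simp at h0
    · simp [phiHat]
  · rw [if_neg h]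
    have h1 := x.2 (i + 1)
    unfold Adm at h1 ⊢
    by_cases hi : i < 0
    · rw [if_pos hi]; rw [if_pos (by omega)] at h1; exact h1
    · rw [if_neg hi]; rw [if_neg (by omega)] at h1; exact h1

/-- The zip shift map `σ_φ`. -/
def zipShift (x : ZipSpace Sm Sp) : ZipSpace Sm Sp :=
  ⟨fun i => if i = -1 then phiHat φ (x.1 0) else x.1 (i + 1), adm_shift φ x⟩

/-- The cylinder `C^s_i = {x : x_i = s}`. -/
def cyl (i : ℤ) (s : Sm ⊕ Sp) : Set (ZipSpace Sm Sp) := {x | x.1 i = s}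

/-- The σ-algebra on the zip shift space, generated by the cylinders. -/
instance zipMS : MeasurableSpace (ZipSpace Sm Sp) :=
  .generateFrom {C | ∃ i s, C = cyl i s}

/-- The partition `𝒞_i` of `Σ` by cylinders of index `i`. -/
def cylPart (i : ℤ) : Set (Set (ZipSpace Sm Sp)) :=
  {C | ∃ s : Sm ⊕ Sp, Adm i s ∧ C = cyl i s}

/-- Forward image of a partition: `f(P) = {f(A) : A ∈ P}`. -/
def pushPart {α : Type*} (f : α → α) (P : Set (Set α)) : Set (Set α) :=
  (Set.image f) '' P

/-- Pullback of a partition: `f⁻¹(P) = {f⁻¹(A) : A ∈ P}`. -/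
def pullPart {α : Type*} (f : α → α) (P : Set (Set α)) : Set (Set α) :=
  (Set.preimage f) '' P

/-- `σ^j(P)` for `j : ℤ`: forward image for `j ≥ 0`, preimage for `j < 0`. -/
def powPart {α : Type*} (f : α → α) (j : ℤ) (P : Set (Set α)) : Set (Set α) :=
  if 0 ≤ j then pushPart (f^[j.toNat]) P else pullPart (f^[(-j).toNat]) P

/-- Common refinement (correfinement) `⋁_{i ∈ t} P i` of a family of partitions:
all nonempty intersections of one element from each partition. -/
def corefine {α ι : Type*} (t : Set ι) (P : ι → Set (Set α)) : Set (Set α) :=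
  {A | A.Nonempty ∧ ∃ g : ι → Set α, (∀ i ∈ t, g i ∈ P i) ∧ A = ⋂ i ∈ t, g i}

/-- The partition `𝒞_{n,…,n'}` by cylinders of indices from `n` to `n'`. -/
def cylRange (n n' : ℤ) : Set (Set (ZipSpace Sm Sp)) :=
  corefine (Set.Icc n n') cylPart

/-- The `k`-th dynamical correfinement `⋁_{j=0}^{k-1} f^{-j}(P)`. -/
def dynRefine {α : Type*} (f : α → α) (P : Set (Set α)) (k : ℕ) : Set (Set α) :=
  corefine (Set.Iio k) (fun j : ℕ => pullPart (f^[j]) P)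

/-- Entropy of a partition: `H_μ(P) = Σ_{A ∈ P} -μ(A) log μ(A)`. -/
noncomputable def partH {α : Type*} [MeasurableSpace α] (μ : Measure α)
    (P : Set (Set α)) : ℝ :=
  ∑' A : P, Real.negMulLog ((μ (A : Set α)).toReal)

variable (pp : Sp → ℝ) [Fintype Sp] [DecidableEq Sm]

/-- The pushforward distribution `p⁻ = φ_* p⁺` on the negative symbols. -/
def pm (t : Sm) : ℝ := ∑ s ∈ Finset.univ.filter (fun s => φ s = t), pp s

/-- The weight of symbol `s` at coordinate `i`: `p⁺_s` for a positive symbol at `i ≥ 0`,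
`p⁻_s` for a negative symbol at `i < 0`, and `0` for inadmissible pairs. -/
def wt : ℤ → Sm ⊕ Sp → ℝ
  | i, .inl t => if i < 0 then pm φ pp t else 0
  | i, .inr s => if 0 ≤ i then pp s else 0

/-- `μ` is the product measure determined by `p⁺` (coordinates independent, coordinate `i`
distributed as `p⁺` for `i ≥ 0` and as `p⁻ = φ_* p⁺` for `i < 0`). -/
def IsProductMeasure (μ : Measure (ZipSpace Sm Sp)) : Prop :=
  ∀ (F : Finset ℤ) (c : ℤ → Sm ⊕ Sp),
    μ {x : ZipSpace Sm Sp | ∀ i ∈ F, x.1 i = c i}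
      = ∏ i ∈ F, ENNReal.ofReal (wt φ pp i (c i))

/-- The fiber space `σ⁻¹(ε) = {σ⁻¹({x}) : x ∈ Σ}`: the partition of `Σ` into
preimages of points, viewed as a type. -/
def Fib (φ : Sp → Sm) := {A : Set (ZipSpace Sm Sp) // ∃ x, A = zipShift φ ⁻¹' {x}}

/-- The natural projection `π : Σ → σ⁻¹(ε)`, `π(y) = σ⁻¹({σ(y)})`. -/
def fibProj (y : ZipSpace Sm Sp) : Fib φ :=
  ⟨zipShift φ ⁻¹' {zipShift φ y}, zipShift φ y, rfl⟩

/-- The quotient σ-algebra on `σ⁻¹(ε)`: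
`Q` is measurable iff `π⁻¹(Q)` is measurable in `Σ`. -/
instance fibMS : MeasurableSpace (Fib φ) :=
  MeasurableSpace.map (fibProj φ) (zipMS)

/-- `X̂ = {x̂ : x ∈ X}`, the set of fibers of points of `X`. -/
def hatSet (X : Set (ZipSpace Sm Sp)) : Set (Fib φ) :=
  {A | ∃ x ∈ X, A.1 = zipShift φ ⁻¹' {x}}

/-- The negative symbol `x_{-1}` of a point of the zip shift space. -/
def negSym (x : ZipSpace Sm Sp) : Sm :=
  (x.1 (-1)).getLeft (by
    have h := x.2 (-1)
    simpa [Adm, if_pos (by norm_num : (-1:ℤ) < 0)] using h)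

/-- The preimage `x̂(s) = (…, x_{-2}; s, x_0, x_1, …)` of `x` under the zip shift,
determined by the choice of positive symbol `s ∈ φ⁻¹(x_{-1})` at coordinate `0`. -/
def prePoint (x : ZipSpace Sm Sp) (s : Sp) : ZipSpace Sm Sp :=
  ⟨fun j => if j = 0 then .inr s else x.1 (j - 1), by
    intro j
    dsimp only
    by_cases h : j = 0
    · subst h
      simp [Adm]
    · rw [if_neg h]
      have h1 := x.2 (j - 1)
      unfold Adm at h1 ⊢
      by_cases hj : j < 0
      · rw [if_pos hj]; rw [if_pos (by omega)] at h1; exact h1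
      · rw [if_neg hj]; rw [if_neg (by omega)] at h1; exact h1⟩

/-- The conditional measure `μ_{x̂}` on the fiber `x̂ = σ⁻¹({x})`, giving mass
`q^{x_{-1}}_s = p⁺_s / p⁻_{x_{-1}}` to the point `x̂(s)`, `s ∈ φ⁻¹(x_{-1})`. -/
noncomputable def condMeas (x : ZipSpace Sm Sp) : Measure (ZipSpace Sm Sp) :=
  ∑ s ∈ Finset.univ.filter (fun s => φ s = negSym x),
    (ENNReal.ofReal (pp s / pm φ pp (negSym x))) • Measure.dirac (prePoint x s)

/-- The conditional measure attached to a fiber `A ∈ σ⁻¹(ε)`. -/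
noncomputable def condMeasFib (A : Fib φ) : Measure (ZipSpace Sm Sp) :=
  condMeas φ pp A.2.choose

/-- The entropy `H_{μ_{x̂}}(ε|_{x̂})` of the restriction of the atomic partition to the
fiber `x̂`, with respect to the conditional measure `μ_{x̂}`. -/
noncomputable def fibH (A : Fib φ) : ℝ :=
  ∑' y : A.1,
    Real.negMulLog ((condMeasFib φ pp A {(y : ZipSpace Sm Sp)}).toReal)

/-- The folding entropy `F(σ) = ∫ H_{μ_{x̂}}(ε|_{x̂}) dμ̂(x̂)`, where `μ̂ = π_* μ` is the
quotient measure on `σ⁻¹(ε)`. -/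
noncomputable def foldH (μ : Measure (ZipSpace Sm Sp)) : ℝ :=
  ∫ A, fibH φ pp A ∂(μ.map (fibProj φ))

/-- A finite measurable partition (mod 0) of a probability space. -/
def IsFinPart {α : Type*} [MeasurableSpace α] (μ : Measure α) (P : Set (Set α)) : Prop :=
  P.Finite ∧ (∀ A ∈ P, MeasurableSet A) ∧ P.Pairwise Disjoint ∧ μ (⋃₀ P) = 1


/-- The Kolmogorov–Sinai entropy: the supremum, over all finite measurable partitions `P`,
of the limits `h_μ(f, P) = lim_n H_μ(⋁_{j=0}^{n-1} f^{-j}P)/n`. -/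
noncomputable def ksEntropy {α : Type*} [MeasurableSpace α] (μ : Measure α) (f : α → α) : ℝ :=
  sSup {h : ℝ | ∃ P : Set (Set α), IsFinPart μ P ∧
    Tendsto (fun n : ℕ => partH μ (dynRefine f P n) / n) atTop (nhds h)}


end ZipShiftPaper

open ZipShiftPaper

namespace ZipShiftPaper

variable {Sm Sp : Type*}

/-- The cylinder of the points that agree with `c` on the finite index set `F`. -/
def finCyl (F : Finset ℤ) (c : ℤ → Sm ⊕ Sp) : Set (ZipSpace Sm Sp) := {x | ∀ i ∈ F, x.1 i = c i}

lemma measurableSet_cyl (i : ℤ) (s : Sm ⊕ Sp) : MeasurableSet (cyl i s) :=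
  MeasurableSpace.measurableSet_generateFrom ⟨i, s, rfl⟩

lemma measurableSet_finCyl (F : Finset ℤ) (c : ℤ → Sm ⊕ Sp) : MeasurableSet (finCyl F c) := by
  have h : finCyl F c = ⋂ i ∈ F, cyl i (c i) := by
    ext x
    simp [finCyl, cyl]
  rw [h]
  exact Finset.measurableSet_biInter F fun i _ => measurableSet_cyl i (c i)

lemma exists_coord_zero (x : ZipSpace Sm Sp) : ∃ s, x.1 0 = .inr s := by
  have h := x.2 0
  simp only [Adm, lt_irrefl, if_false] at h
  exact Sum.isRight_iff.mp h

lemma inl_negSym (x : ZipSpace Sm Sp) : Sum.inl (negSym x) = x.1 (-1) := by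
  simp [negSym]

/-- The cylinders over finite index sets containing `0`, based at points of the space. -/
def zeroCylinders (Sm Sp : Type*) : Set (Set (ZipSpace Sm Sp)) :=
  {C | ∃ F : Finset ℤ, 0 ∈ F ∧ ∃ z : ZipSpace Sm Sp, C = finCyl F z.1}

lemma isPiSystem_zeroCylinders : IsPiSystem (zeroCylinders Sm Sp) := by
  rintro _ ⟨F, hF, z, rfl⟩ _ ⟨G, -, w, rfl⟩ ⟨v, hv, hv'⟩
  refine ⟨F ∪ G, Finset.mem_union_left _ hF, v, ?_⟩
  ext x
  simp only [finCyl, Set.mem_inter_iff, Set.mem_ofPred_eq, Finset.mem_union] at hv hv' ⊢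
  grind

lemma generateFrom_zeroCylinders [Finite Sp] :
    (zipMS : MeasurableSpace (ZipSpace Sm Sp)) = .generateFrom (zeroCylinders Sm Sp) := by
  apply le_antisymm
  · refine MeasurableSpace.generateFrom_le ?_
    rintro _ ⟨i, s, rfl⟩
    have h : (cyl i s : Set (ZipSpace Sm Sp)) = ⋃ t : Sp, cyl i s ∩ cyl 0 (.inr t) := by
      ext x
      obtain ⟨t, ht⟩ := exists_coord_zero x
      simp [cyl, ht]
    rw [h]
    refine MeasurableSet.iUnion fun t => ?_
    rcases Set.eq_empty_or_nonempty (cyl i s ∩ cyl 0 (.inr t) : Set (ZipSpace Sm Sp))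
      with h0 | ⟨z, hz, hz'⟩
    · rw [h0]
      exact @MeasurableSet.empty _ (.generateFrom _)
    · refine MeasurableSpace.measurableSet_generateFrom ⟨{0, i}, by simp, z, ?_⟩
      ext x
      simp only [cyl, Set.mem_ofPred_eq] at hz hz'
      simp [finCyl, cyl, hz, hz', and_comm]
  · refine MeasurableSpace.generateFrom_le ?_
    rintro _ ⟨F, -, z, rfl⟩
    exact measurableSet_finCyl F z.1

lemma measurable_zipShift [Finite Sm] [Finite Sp] (φ : Sp → Sm) : Measurable (zipShift φ) := by
  refine measurable_generateFrom ?_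
  rintro _ ⟨i, s, rfl⟩
  by_cases hi : i = -1
  · subst hi
    have h : zipShift φ ⁻¹' cyl (-1) s = ⋃ t ∈ {t | phiHat φ t = s}, cyl 0 t := by
      ext x
      simp [zipShift, cyl]
    rw [h]
    exact MeasurableSet.biUnion (Set.to_countable _) fun t _ => measurableSet_cyl 0 t
  · have h : zipShift φ ⁻¹' cyl i s = cyl (i + 1) s := by
      ext x
      simp [zipShift, cyl, hi]
    rw [h]
    exact measurableSet_cyl _ _

lemma measurable_prePoint (s : Sp) : Measurable fun x : ZipSpace Sm Sp => prePoint x s := by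
  refine measurable_generateFrom ?_
  rintro _ ⟨i, t, rfl⟩
  by_cases hi : i = 0
  · subst hi
    exact MeasurableSet.const (Sum.inr s = t)
  · have h : (fun x : ZipSpace Sm Sp => prePoint x s) ⁻¹' cyl i t = cyl (i - 1) t := by
      ext x
      change (if i = 0 then .inr s else x.1 (i - 1)) = t ↔ x.1 (i - 1) = t
      rw [if_neg hi]
    rw [h]
    exact measurableSet_cyl _ _

lemma zipShift_prePoint (φ : Sp → Sm) (x : ZipSpace Sm Sp) {s : Sp} (hs : φ s = negSym x) :
    zipShift φ (prePoint x s) = x := by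
  apply Subtype.ext
  funext i
  by_cases hi : i = -1
  · subst hi
    simp [zipShift, prePoint, phiHat, hs, inl_negSym]
  · have h : i + 1 ≠ 0 := by omega
    simp [zipShift, prePoint, hi, h]

lemma prePoint_zipShift_apply (φ : Sp → Sm) (y : ZipSpace Sm Sp) (s : Sp) (i : ℤ) :
    (prePoint (zipShift φ y) s).1 i = if i = 0 then .inr s else y.1 i := by
  by_cases hi : i = 0
  · simp [prePoint, hi]
  · simp [prePoint, zipShift, hi]

lemma negSym_zipShift (φ : Sp → Sm) {y : ZipSpace Sm Sp} {u : Sp} (hu : y.1 0 = .inr u) :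
    negSym (zipShift φ y) = φ u := by
  apply Sum.inl_injective (β := Sp)
  rw [inl_negSym]
  simp [zipShift, hu, phiHat]

lemma measurable_fibProj (φ : Sp → Sm) : Measurable (fibProj φ) := fun _ h => h

section Disintegration

variable [Fintype Sp] [DecidableEq Sm] {φ : Sp → Sm} {pp : Sp → ℝ}

lemma sum_ofReal_div_pm (hpp : ∀ s, 0 ≤ pp s) {t : Sm} (ht : 0 < pm φ pp t) :
    ∑ s ∈ Finset.univ.filter (fun s => φ s = t), ENNReal.ofReal (pp s / pm φ pp t) = 1 := by
  rw [← ENNReal.ofReal_sum_of_nonneg fun s _ => div_nonneg (hpp s) ht.le, ← Finset.sum_div]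
  change ENNReal.ofReal (pm φ pp t / pm φ pp t) = 1
  rw [div_self ht.ne', ENNReal.ofReal_one]

lemma condMeas_eq_one (hpp : ∀ s, 0 ≤ pp s) (hpm : ∀ t, 0 < pm φ pp t) (x : ZipSpace Sm Sp)
    {A : Set (ZipSpace Sm Sp)} (hA : zipShift φ ⁻¹' {x} ⊆ A) : condMeas φ pp x A = 1 := by
  rw [condMeas, Measure.finsetSum_apply, ← sum_ofReal_div_pm hpp (hpm (negSym x))]
  refine Finset.sum_congr rfl fun s hs => ?_
  have h : prePoint x s ∈ A := hA (zipShift_prePoint φ x (Finset.mem_filter.mp hs).2)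
  simp [Measure.dirac_apply_of_mem h]

lemma condMeas_apply (x : ZipSpace Sm Sp) {M : Set (ZipSpace Sm Sp)} (hM : MeasurableSet M) :
    condMeas φ pp x M = ∑ s, {x | φ s = negSym x}.indicator (fun x =>
      ENNReal.ofReal (pp s / pm φ pp (φ s)) * M.indicator 1 (prePoint x s)) x := by
  rw [condMeas, Measure.finsetSum_apply, Finset.sum_filter]
  refine Finset.sum_congr rfl fun s _ => ?_
  by_cases hs : φ s = negSym x
  · simp [hs, Measure.dirac_apply' _ hM]
  · simp [hs]

lemma measurable_condMeas : Measurable (condMeas φ pp) := by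
  refine Measure.measurable_of_measurable_coe _ fun M hM => ?_
  simp_rw [condMeas_apply _ hM]
  refine Finset.measurable_sum _ fun s _ => Measurable.indicator ?_ ?_
  · exact measurable_const.mul ((measurable_one.indicator hM).comp (measurable_prePoint s))
  · have h : {x : ZipSpace Sm Sp | φ s = negSym x} = cyl (-1) (.inl (φ s)) := by
      ext x
      simp [cyl, ← inl_negSym, eq_comm]
    rw [h]
    exact measurableSet_cyl _ _

lemma condMeasFib_fibProj (y : ZipSpace Sm Sp) :
    condMeasFib φ pp (fibProj φ y) = condMeas φ pp (zipShift φ y) := by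
  have h := (fibProj φ y).2.choose_spec
  have hy : y ∈ (fibProj φ y).1 := rfl
  rw [h] at hy
  rw [condMeasFib, show zipShift φ y = _ from hy]

lemma measurable_condMeasFib [Finite Sm] : Measurable (condMeasFib φ pp) := by
  intro Q hQ
  change MeasurableSet ((condMeasFib φ pp ∘ fibProj φ) ⁻¹' Q)
  rw [show condMeasFib φ pp ∘ fibProj φ = condMeas φ pp ∘ zipShift φ from
    funext condMeasFib_fibProj]
  exact (measurable_condMeas.comp (measurable_zipShift φ)) hQ

lemma condMeas_zipShift_finCyl (y z : ZipSpace Sm Sp) {F : Finset ℤ} (hF : 0 ∈ F) {s₀ : Sp}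
    (hz : z.1 0 = .inr s₀) :
    condMeas φ pp (zipShift φ y) (finCyl F z.1) =
      (⋃ t ∈ Finset.univ.filter (fun t => φ t = φ s₀),
        finCyl F (Function.update z.1 0 (.inr t))).indicator
          (fun _ => ENNReal.ofReal (pp s₀ / pm φ pp (φ s₀))) y := by
  classical
  obtain ⟨u, hu⟩ := exists_coord_zero y
  have hmem (s : Sp) : prePoint (zipShift φ y) s ∈ finCyl F z.1 ↔
      s = s₀ ∧ ∀ i ∈ F, i ≠ 0 → y.1 i = z.1 i := by
    simp only [finCyl, Set.mem_ofPred_eq, prePoint_zipShift_apply]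
    constructor
    · intro h
      refine ⟨by simpa [hz] using h 0 hF, fun i hi hi0 => by simpa [hi0] using h i hi⟩
    · rintro ⟨rfl, h⟩ i hi
      by_cases hi0 : i = 0
      · simp [hi0, hz]
      · simpa [hi0] using h i hi hi0
  have hD : y ∈ (⋃ t ∈ Finset.univ.filter (fun t => φ t = φ s₀),
      finCyl F (Function.update z.1 0 (.inr t))) ↔
      φ s₀ = φ u ∧ ∀ i ∈ F, i ≠ 0 → y.1 i = z.1 i := by
    simp only [finCyl, Set.mem_iUnion, Finset.mem_filter, Finset.mem_univ, true_and,
      Set.mem_ofPred_eq, exists_prop]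
    constructor
    · rintro ⟨t, ht, h⟩
      have h0 := h 0 hF
      simp only [hu, Function.update_self, Sum.inr.injEq] at h0
      exact ⟨by rw [h0, ht], fun i hi hi0 => by simpa [hi0] using h i hi⟩
    · rintro ⟨hs, h⟩
      refine ⟨u, hs.symm, fun i hi => ?_⟩
      by_cases hi0 : i = 0
      · simp [hi0, hu]
      · simpa [hi0] using h i hi hi0
  rw [condMeas_apply _ (measurableSet_finCyl F z.1), Finset.sum_eq_single s₀]
  · simp only [Set.indicator_apply, Set.mem_ofPred_eq, negSym_zipShift φ hu, hmem, hD]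
    by_cases h1 : φ s₀ = φ u <;> by_cases h2 : ∀ i ∈ F, i ≠ 0 → y.1 i = z.1 i <;> simp [h1, h2]
  · intro s _ hs
    simp [Set.indicator_apply, hmem, hs]
  · simp

lemma IsProductMeasure.finCyl_update {μ : Measure (ZipSpace Sm Sp)}
    (hμ : IsProductMeasure φ pp μ) {F : Finset ℤ} (hF : 0 ∈ F) (c : ℤ → Sm ⊕ Sp) (t : Sp) :
    μ (finCyl F (Function.update c 0 (.inr t))) =
      ENNReal.ofReal (pp t) * ∏ i ∈ F.erase 0, ENNReal.ofReal (wt φ pp i (c i)) := by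
  have h := hμ F (Function.update c 0 (.inr t))
  rw [← Finset.mul_prod_erase F _ hF] at h
  refine h.trans (congrArg₂ _ (by simp [wt]) (Finset.prod_congr rfl fun i hi => ?_))
  rw [Function.update_of_ne (Finset.ne_of_mem_erase hi)]

lemma IsProductMeasure.isProbabilityMeasure {μ : Measure (ZipSpace Sm Sp)}
    (hμ : IsProductMeasure φ pp μ) [Nonempty Sp] : IsProbabilityMeasure μ :=
  ⟨by simpa using hμ ∅ fun _ => .inr (Classical.arbitrary Sp)⟩

lemma IsProductMeasure.lintegral_condMeas_finCyl [Finite Sm] {μ : Measure (ZipSpace Sm Sp)}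
    (hμ : IsProductMeasure φ pp μ) (hpp : ∀ s, 0 ≤ pp s) (hpm : ∀ t, 0 < pm φ pp t)
    {F : Finset ℤ} (hF : 0 ∈ F) (z : ZipSpace Sm Sp) :
    ∫⁻ y, condMeas φ pp (zipShift φ y) (finCyl F z.1) ∂μ = μ (finCyl F z.1) := by
  obtain ⟨s₀, hz⟩ := exists_coord_zero z
  simp_rw [condMeas_zipShift_finCyl _ z hF hz]
  rw [lintegral_indicator_const (Finset.measurableSet_biUnion _ fun t _ =>
    measurableSet_finCyl F _), measure_biUnion_finset ?_ fun t _ => measurableSet_finCyl F _]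
  · simp_rw [hμ.finCyl_update hF]
    rw [← Finset.sum_mul, ← ENNReal.ofReal_sum_of_nonneg fun s _ => hpp s]
    change _ * (ENNReal.ofReal (pm φ pp (φ s₀)) * _) = _
    rw [← mul_assoc, ← ENNReal.ofReal_mul (div_nonneg (hpp s₀) (hpm _).le),
      div_mul_cancel₀ _ (hpm _).ne', ← hμ.finCyl_update hF z.1 s₀, ← hz, Function.update_eq_self]
  · intro t _ t' _ htt'
    refine Set.disjoint_left.mpr fun y hy hy' => htt' ?_
    have h := (hy 0 hF).symm.trans (hy' 0 hF)
    simpa using h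

lemma IsProductMeasure.bind_condMeas [Finite Sm] [Nonempty Sp] {μ : Measure (ZipSpace Sm Sp)}
    (hμ : IsProductMeasure φ pp μ) (hpp : ∀ s, 0 ≤ pp s) (hpm : ∀ t, 0 < pm φ pp t) :
    μ = μ.bind (condMeas φ pp ∘ zipShift φ) := by
  have := hμ.isProbabilityMeasure
  have hmeas : AEMeasurable (condMeas φ pp ∘ zipShift φ) μ :=
    (measurable_condMeas.comp (measurable_zipShift φ)).aemeasurable
  refine ext_of_generate_finite _ generateFrom_zeroCylinders isPiSystem_zeroCylinders ?_ ?_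
  · rintro _ ⟨F, hF, z, rfl⟩
    rw [Measure.bind_apply (measurableSet_finCyl F z.1) hmeas]
    exact (hμ.lintegral_condMeas_finCyl hpp hpm hF z).symm
  · rw [Measure.bind_apply .univ hmeas]
    simp [condMeas_eq_one hpp hpm _ (Set.subset_univ _)]

end Disintegration

end ZipShiftPaper

/-- the family `(μ_{x̂})` is a disintegration of `μ` with respect to `σ⁻¹(ε)`. -/
theorem statement14 {Sm Sp : Type*} [Fintype Sm] [Fintype Sp] [Nonempty Sm] [Nonempty Sp]
    [DecidableEq Sm]
    (φ : Sp → Sm) (hφ : Function.Surjective φ)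
    (pp : Sp → ℝ) (hpp : ∀ s, 0 ≤ pp s) (hsum : ∑ s, pp s = 1)
    (hpm : ∀ t : Sm, 0 < pm φ pp t)
    (μ : Measure (ZipSpace Sm Sp)) (hμ : IsProductMeasure φ pp μ) :
    (∀ x : ZipSpace Sm Sp, IsProbabilityMeasure (condMeas φ pp x) ∧
        condMeas φ pp x (zipShift φ ⁻¹' {x}) = 1) ∧
    (∀ M : Set (ZipSpace Sm Sp), MeasurableSet M →
        Measurable fun A : Fib φ => condMeasFib φ pp A M) ∧
    (∀ M : Set (ZipSpace Sm Sp), MeasurableSet M →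
        μ M = ∫⁻ A, condMeasFib φ pp A M ∂(μ.map (fibProj φ))) := by
  have hmeas (M : Set (ZipSpace Sm Sp)) (hM : MeasurableSet M) :
      Measurable fun A : Fib φ => condMeasFib φ pp A M :=
    (Measure.measurable_coe hM).comp measurable_condMeasFib
  refine ⟨fun x => ⟨⟨condMeas_eq_one hpp hpm x (Set.subset_univ _)⟩,
    condMeas_eq_one hpp hpm x subset_rfl⟩, hmeas, fun M hM => ?_⟩
  rw [lintegral_map (hmeas M hM) (measurable_fibProj φ)]
  simp_rw [condMeasFib_fibProj]
  conv_lhs => rw [hμ.bind_condMeas hpp hpm]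
  exact Measure.bind_apply hM
    (measurable_condMeas.comp (measurable_zipShift φ)).aemeasurable
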